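/- Let T₁, T₂ be two non-trivial actions of a group G on ℝ-trees, and assume the minimal subtree of T₁ is dense in T₁. Then for every direction δ₁ in T₁ there exists an element h ∈ G which is hyperbolic in both T₁ and T₂ and which has a positive semi-axis in T₁ contained in δ₁. -/

import Mathlib

/-!
Formalization of definitions from V. Guirardel,
"Core and intersection number for group actions on trees".
-/

open Set Metric Filter Function Topology
open scoped ENNReal Pointwise

noncomputable section

namespace Guirardel

/-- The metric segment `[x,y]`: the set of points lying metrically between `x` and `y`.
In an `ℝ`-tree this is the image of the geodesic from `x` to `y`. -/
def seg {T : Type*} [MetricSpace T] (x y : T) : Set T :=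
  {p : T | dist x p + dist p y = dist x y}

/-- The open segment `]x,y[`. -/
def openSeg {T : Type*} [MetricSpace T] (x y : T) : Set T :=
  seg x y \ {x, y}

/-- A subset of an `ℝ`-tree is convex (i.e. a subtree when nonempty) if it contains the
segment between any two of its points. -/
def TreeConvex {T : Type*} [MetricSpace T] (S : Set T) : Prop :=
  ∀ x ∈ S, ∀ y ∈ S, seg x y ⊆ S

/-- An `ℝ`-tree: any two points are joined by a geodesic, and any two injective paths
with the same endpoints have the same image (uniqueness of arcs). -/
structure IsRTree (T : Type*) [MetricSpace T] : Prop where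
  exists_geod : ∀ x y : T, ∃ f : ℝ → T, f 0 = x ∧ f (dist x y) = y ∧
    ∀ s ∈ Icc (0 : ℝ) (dist x y), ∀ t ∈ Icc (0 : ℝ) (dist x y),
      dist (f s) (f t) = |s - t|
  arc_unique : ∀ (x y : T) (γ₁ γ₂ : Path x y),
    Function.Injective γ₁ → Function.Injective γ₂ →
      Set.range γ₁ = Set.range γ₂

/-- A direction based at `x`: a connected component of the complement of `x`. -/
def IsDirectionAt {T : Type*} [MetricSpace T] (δ : Set T) (x : T) : Prop :=
  ∃ y : T, y ≠ x ∧ δ = connectedComponentIn {x}ᶜ y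

/-- A direction in a tree. -/
def IsDirection {T : Type*} [MetricSpace T] (δ : Set T) : Prop :=
  ∃ x : T, IsDirectionAt δ x

/-- A branch point: a point with at least three directions. -/
def IsBranchPoint {T : Type*} [MetricSpace T] (x : T) : Prop :=
  ∃ δ₁ δ₂ δ₃ : Set T, IsDirectionAt δ₁ x ∧ IsDirectionAt δ₂ x ∧ IsDirectionAt δ₃ x ∧
    δ₁ ≠ δ₂ ∧ δ₁ ≠ δ₃ ∧ δ₂ ≠ δ₃

/-- A quadrant in `T₁ × T₂`: a product of two directions. -/
def IsQuadrant {T₁ T₂ : Type*} [MetricSpace T₁] [MetricSpace T₂]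
    (Q : Set (T₁ × T₂)) : Prop :=
  ∃ (δ₁ : Set T₁) (δ₂ : Set T₂), IsDirection δ₁ ∧ IsDirection δ₂ ∧ Q = δ₁ ×ˢ δ₂

/-- A quadrant is heavy if (for every choice of base point, which does not matter) there
is a sequence of orbit points inside it whose two coordinates go to infinity. -/
def Heavy (G : Type*) {T₁ T₂ : Type*} [Group G] [MetricSpace T₁] [MetricSpace T₂]
    [MulAction G T₁] [MulAction G T₂] (Q : Set (T₁ × T₂)) : Prop :=
  ∀ p : T₁ × T₂, ∃ γ : ℕ → G,
    (∀ k, ((γ k • p.1 : T₁), (γ k • p.2 : T₂)) ∈ Q) ∧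
    Tendsto (fun k => dist (γ k • p.1) p.1) atTop atTop ∧
    Tendsto (fun k => dist (γ k • p.2) p.2) atTop atTop

/-- The core of `T₁ × T₂`: the complement of the union of all light (i.e. non-heavy)
quadrants; equivalently the set of points all of whose quadrants are heavy. -/
def Core (G T₁ T₂ : Type*) [Group G] [MetricSpace T₁] [MetricSpace T₂]
    [MulAction G T₁] [MulAction G T₂] : Set (T₁ × T₂) :=
  {z : T₁ × T₂ | ∀ Q : Set (T₁ × T₂), IsQuadrant Q → z ∈ Q → Heavy G Q}

/-- A subset of `T₁ × T₂` has convex fibers if its horizontal and vertical fibers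
are convex. -/
def ConvexFibers {T₁ T₂ : Type*} [MetricSpace T₁] [MetricSpace T₂]
    (E : Set (T₁ × T₂)) : Prop :=
  (∀ x₁ : T₁, TreeConvex {y₂ : T₂ | (x₁, y₂) ∈ E}) ∧
  (∀ x₂ : T₂, TreeConvex {y₁ : T₁ | (y₁, x₂) ∈ E})

/-- The action of `G` on `T` is by isometries. -/
def IsometricAction (G T : Type*) [MetricSpace T] [SMul G T] : Prop :=
  ∀ (g : G) (x y : T), dist (g • x) (g • y) = dist x y

/-- `g` is elliptic: it fixes a point of `T`. -/
def Elliptic {G : Type*} (T : Type*) [SMul G T] (g : G) : Prop :=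
  ∃ x : T, g • x = x

/-- `g` is hyperbolic: it fixes no point of `T`. -/
def Hyperbolic {G : Type*} (T : Type*) [SMul G T] (g : G) : Prop :=
  ∀ x : T, g • x ≠ x

/-- Translation length of `g` on `T`. -/
def translationLength {G : Type*} (T : Type*) [MetricSpace T] [SMul G T] (g : G) : ℝ :=
  ⨅ x : T, dist x (g • x)

/-- The axis (characteristic set) of `g`: points minimizing displacement. -/
def axisSet {G : Type*} (T : Type*) [MetricSpace T] [SMul G T] (g : G) : Set T :=
  {x : T | ∀ y : T, dist x (g • x) ≤ dist y (g • y)}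

/-- The action is non-trivial: some element is hyperbolic. -/
def NontrivialAction (G T : Type*) [SMul G T] : Prop :=
  ∃ g : G, ∀ x : T, g • x ≠ x

/-- The action is free: only the identity fixes a point. -/
def FreeAction (G T : Type*) [Group G] [MulAction G T] : Prop :=
  ∀ g : G, g ≠ 1 → ∀ x : T, g • x ≠ x

/-- The action is minimal: no proper nonempty invariant subtree. -/
def MinimalAction (G T : Type*) [MetricSpace T] [SMul G T] : Prop :=
  ∀ S : Set T, S.Nonempty → TreeConvex S → (∀ g : G, ∀ x ∈ S, g • x ∈ S) → S = univ

/-- The minimal subtree for the subset `H` of `G`: the intersection of all nonempty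
invariant subtrees. -/
def minSubtreeOf {G : Type*} (H : Set G) (T : Type*) [MetricSpace T] [SMul G T] : Set T :=
  ⋂₀ {S : Set T | S.Nonempty ∧ TreeConvex S ∧ ∀ g ∈ H, ∀ x ∈ S, g • x ∈ S}

/-- The minimal subtree of the `G`-action. -/
def minSubtree (G T : Type*) [MetricSpace T] [SMul G T] : Set T :=
  minSubtreeOf (univ : Set G) T

/-- A line in `T`: the image of an isometric embedding of `ℝ`. -/
def IsLine {T : Type*} [MetricSpace T] (L : Set T) : Prop :=
  ∃ f : ℝ → T, (∀ s t : ℝ, dist (f s) (f t) = |s - t|) ∧ L = range f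

/-- A ray in `T`: the image of an isometric embedding of `[0,∞)`. -/
def IsRay {T : Type*} [MetricSpace T] (R : Set T) : Prop :=
  ∃ f : ℝ → T, (∀ s ∈ Ici (0 : ℝ), ∀ t ∈ Ici (0 : ℝ), dist (f s) (f t) = |s - t|) ∧
    R = f '' Ici 0

/-- Two rays (or subsets) define the same end when they are at finite Hausdorff distance. -/
def SameEnd {T : Type*} [MetricSpace T] (R R' : Set T) : Prop :=
  EMetric.hausdorffEdist R R' ≠ ⊤

/-- The action of `G` fixes an end of `T`. -/
def GFixedEnd (G T : Type*) [MetricSpace T] [SMul G T] : Prop :=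
  ∃ R : Set T, IsRay R ∧ ∀ g : G, SameEnd ((fun x => g • x) '' R) R

/-- The action of `G` has an invariant line. -/
def GInvariantLine (G T : Type*) [MetricSpace T] [SMul G T] : Prop :=
  ∃ L : Set T, IsLine L ∧ ∀ g : G, (fun x => g • x) '' L = L

/-- The action is irreducible: no invariant line and no fixed end. -/
def IrreducibleAction (G T : Type*) [MetricSpace T] [SMul G T] : Prop :=
  ¬ GInvariantLine G T ∧ ¬ GFixedEnd G T

/-- The action is dihedral: there is an invariant line on which some element acts as a
reflection (i.e. with non-constant displacement along the line). -/
def DihedralAction (G T : Type*) [MetricSpace T] [SMul G T] : Prop :=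
  ∃ L : Set T, IsLine L ∧ (∀ g : G, (fun x => g • x) '' L = L) ∧
    ∃ g : G, ∃ x ∈ L, ∃ y ∈ L, dist x (g • x) ≠ dist y (g • y)

/-- `A` is a positive semi-axis of `g`: a ray contained in the axis of `g` and mapped
into itself by `g`. -/
def PosSemiAxis {G : Type*} (T : Type*) [MetricSpace T] [SMul G T] (g : G) (A : Set T) :
    Prop :=
  IsRay A ∧ A ⊆ axisSet T g ∧ (fun x => g • x) '' A ⊆ A

/-- `g` translates towards the end determined by the ray `R`:
`g` is hyperbolic and has a positive semi-axis defining the same end as `R`. -/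
def TranslatesToward {G : Type*} (T : Type*) [MetricSpace T] [SMul G T] (g : G)
    (R : Set T) : Prop :=
  Hyperbolic T g ∧ ∃ A : Set T, PosSemiAxis T g A ∧ SameEnd A R

/-- The end `ω_T(g)` of the hyperbolic element `g` lies in the set of ends of `δ`:
some positive semi-axis of `g` is contained in `δ`. -/
def EndInSubtree {G : Type*} (T : Type*) [MetricSpace T] [SMul G T] (g : G)
    (δ : Set T) : Prop :=
  ∃ A : Set T, PosSemiAxis T g A ∧ A ⊆ δ

/-- A map between `ℝ`-trees preserves alignment if the image of a point between `y`
and `z` lies between the images of `y` and `z`. -/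
def AlignPreserving {T T' : Type*} [MetricSpace T] [MetricSpace T'] (f : T → T') : Prop :=
  ∀ x y z : T, x ∈ seg y z → f x ∈ seg (f y) (f z)

/-- `f : T → T'` witnesses that `T` is a refinement of `T'`: it is an equivariant
continuous surjection preserving alignment. -/
def IsRefinementMap (G : Type*) {T T' : Type*} [Group G] [MetricSpace T] [MetricSpace T']
    [MulAction G T] [MulAction G T'] (f : T → T') : Prop :=
  Continuous f ∧ Surjective f ∧ AlignPreserving f ∧ ∀ (g : G) (x : T), f (g • x) = g • f x

/-- The length functions of the two actions are homothetic. -/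
def HomotheticLengths (G T₁ T₂ : Type*) [MetricSpace T₁] [MetricSpace T₂] [SMul G T₁]
    [SMul G T₂] : Prop :=
  ∃ c : ℝ, 0 < c ∧ ∀ g : G, translationLength T₁ g = c * translationLength T₂ g

/-- A bundled `ℝ`-tree with an isometric action of `G`. -/
structure GTree (G : Type*) [Group G] where
  carrier : Type
  [ms : MetricSpace carrier]
  [ma : MulAction G carrier]
  isom : ∀ (g : G) (x y : carrier), dist (g • x) (g • y) = dist x y
  tree : IsRTree carrier

attribute [instance] GTree.ms GTree.ma

/-- A simplicial structure on an `ℝ`-tree: a vertex set containing all branch points,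
meeting every segment in a finite set, and discrete. -/
def IsSimplicialStructure {T : Type*} [MetricSpace T] (V : Set T) : Prop :=
  (∀ x : T, IsBranchPoint x → x ∈ V) ∧
  (∀ x y : T, (seg x y ∩ V).Finite) ∧
  (∀ v ∈ V, ∃ ε > 0, ∀ w ∈ V, dist v w < ε → w = v)

/-- Two vertices of a simplicial tree are adjacent (span an edge). -/
def Adjacent {T : Type*} [MetricSpace T] (V : Set T) (v w : T) : Prop :=
  v ∈ V ∧ w ∈ V ∧ v ≠ w ∧ seg v w ∩ V = {v, w}

/-- A bundled simplicial `G`-tree. -/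
structure SimplicialGTree (G : Type*) [Group G] extends GTree G where
  V : Set carrier
  simp : IsSimplicialStructure V
  inv : ∀ g : G, (fun x => g • x) '' V = V

/-- `T₁` and `T₂` are refinements of a common non-trivial simplicial action of `G`. -/
def RefineCommonSimplicial (G T₁ T₂ : Type*) [Group G] [MetricSpace T₁] [MetricSpace T₂]
    [MulAction G T₁] [MulAction G T₂] : Prop :=
  ∃ T' : SimplicialGTree G, NontrivialAction G T'.carrier ∧
    (∃ f₁ : T₁ → T'.carrier, IsRefinementMap G f₁) ∧
    (∃ f₂ : T₂ → T'.carrier, IsRefinementMap G f₂)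

/-- Two directions face each other: their union is the whole tree. -/
def FacingDirections {T : Type*} [MetricSpace T] (δ δ' : Set T) : Prop :=
  δ ∪ δ' = univ

/-- There is a twice-light rectangle with (opposite) base corners `x` and `x'`:
two light quadrants based at `x` and `x'` facing each other. -/
def IsTwiceLightRect (G : Type*) {T₁ T₂ : Type*} [Group G] [MetricSpace T₁]
    [MetricSpace T₂] [MulAction G T₁] [MulAction G T₂] (x x' : T₁ × T₂) : Prop :=
  ∃ (δ₁ : Set T₁) (δ₂ : Set T₂) (δ₁' : Set T₁) (δ₂' : Set T₂),
    IsDirectionAt δ₁ x.1 ∧ IsDirectionAt δ₂ x.2 ∧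
    IsDirectionAt δ₁' x'.1 ∧ IsDirectionAt δ₂' x'.2 ∧
    x.1 ≠ x'.1 ∧ x.2 ≠ x'.2 ∧
    FacingDirections δ₁ δ₁' ∧ FacingDirections δ₂ δ₂' ∧
    ¬ Heavy G (δ₁ ×ˢ δ₂) ∧ ¬ Heavy G (δ₁' ×ˢ δ₂')

/-- The open rectangle with opposite corners `x, x'`. -/
def openRect {T₁ T₂ : Type*} [MetricSpace T₁] [MetricSpace T₂] (x x' : T₁ × T₂) :
    Set (T₁ × T₂) :=
  openSeg x.1 x'.1 ×ˢ openSeg x.2 x'.2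

/-- A maximal twice-light rectangle. -/
def IsMaxTwiceLightRect (G : Type*) {T₁ T₂ : Type*} [Group G] [MetricSpace T₁]
    [MetricSpace T₂] [MulAction G T₁] [MulAction G T₂] (x x' : T₁ × T₂) : Prop :=
  IsTwiceLightRect G x x' ∧ ∀ y y' : T₁ × T₂, IsTwiceLightRect G y y' →
    openRect x x' ⊆ openRect y y' → openRect x x' = openRect y y'

/-- The straight diagonal of a rectangle joining the two opposite corners `p` and `q`. -/
def mainDiag {T₁ T₂ : Type*} [MetricSpace T₁] [MetricSpace T₂] (p q : T₁ × T₂) :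
    Set (T₁ × T₂) :=
  {z : T₁ × T₂ | z.1 ∈ seg p.1 q.1 ∧ z.2 ∈ seg p.2 q.2 ∧
    dist p.1 z.1 * dist p.2 q.2 = dist p.2 z.2 * dist p.1 q.1}

/-- The augmented core: the union of the core and of the main diagonals of the maximal
twice-light rectangles (the diagonals joining the two opposite corners lying in the core). -/
def AugCore (G T₁ T₂ : Type*) [Group G] [MetricSpace T₁] [MetricSpace T₂]
    [MulAction G T₁] [MulAction G T₂] : Set (T₁ × T₂) :=
  Core G T₁ T₂ ∪
    {z : T₁ × T₂ | ∃ x x' p q : T₁ × T₂, IsMaxTwiceLightRect G x x' ∧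
      p ∈ Core G T₁ T₂ ∧ q ∈ Core G T₁ T₂ ∧
      ({p.1, q.1} : Set T₁) = {x.1, x'.1} ∧ ({p.2, q.2} : Set T₂) = {x.2, x'.2} ∧
      p.1 ≠ q.1 ∧ p.2 ≠ q.2 ∧ z ∈ mainDiag p q}

/-- There exists an equivariant (strong) deformation retraction of `T₁ × T₂` onto `C`. -/
def EquivDeformRetract (G : Type*) {T₁ T₂ : Type*} [Group G] [MetricSpace T₁]
    [MetricSpace T₂] [MulAction G T₁] [MulAction G T₂] (C : Set (T₁ × T₂)) : Prop :=
  ∃ H : ℝ → T₁ × T₂ → T₁ × T₂,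
    Continuous (fun p : ℝ × (T₁ × T₂) => H p.1 p.2) ∧
    (∀ z : T₁ × T₂, H 0 z = z) ∧
    (∀ z : T₁ × T₂, H 1 z ∈ C) ∧
    (∀ t : ℝ, ∀ z ∈ C, H t z = z) ∧
    (∀ (t : ℝ) (g : G) (z : T₁ × T₂), H t (g • z) = g • H t z)

/-- The `ℓ²` product distance on `T₁ × T₂`. -/
def dist2 {T₁ T₂ : Type*} [MetricSpace T₁] [MetricSpace T₂] (p q : T₁ × T₂) : ℝ :=
  Real.sqrt (dist p.1 q.1 ^ 2 + dist p.2 q.2 ^ 2)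

/-- The length of a path `c : [0,1] → T₁ × T₂`, measured with the `ℓ²` product metric. -/
def pathLen2 {T₁ T₂ : Type*} [MetricSpace T₁] [MetricSpace T₂] (c : ℝ → T₁ × T₂) :
    ℝ≥0∞ :=
  ⨆ (n : ℕ) (u : Fin (n + 1) → ℝ) (_ : Monotone u) (_ : ∀ i, u i ∈ Icc (0 : ℝ) 1),
    ∑ i : Fin n, ENNReal.ofReal (dist2 (c (u i.castSucc)) (c (u i.succ)))

/-- The path metric induced on a subset `C ⊆ T₁ × T₂` by the `ℓ²` product metric. -/
def pathDistOn {T₁ T₂ : Type*} [MetricSpace T₁] [MetricSpace T₂] (C : Set (T₁ × T₂))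
    (x y : C) : ℝ :=
  (⨅ (c : ℝ → T₁ × T₂) (_ : ContinuousOn c (Icc (0 : ℝ) 1))
      (_ : MapsTo c (Icc (0 : ℝ) 1) C) (_ : c 0 = (x : T₁ × T₂))
      (_ : c 1 = (y : T₁ × T₂)), pathLen2 c).toReal

/-- A distance function makes a set a CAT(0) space: it is a metric, geodesic, and the
CN-inequality of Bruhat–Tits holds (comparison triangles are at least as thick). -/
structure IsCAT0Dist {X : Type*} (d : X → X → ℝ) : Prop where
  refl : ∀ x, d x x = 0
  symm : ∀ x y, d x y = d y x
  triangle : ∀ x y z, d x z ≤ d x y + d y z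
  eq_of_dist_eq_zero : ∀ x y, d x y = 0 → x = y
  geodesic : ∀ x y, ∃ f : ℝ → X, f 0 = x ∧ f (d x y) = y ∧
    ∀ s ∈ Icc (0 : ℝ) (d x y), ∀ t ∈ Icc (0 : ℝ) (d x y), d (f s) (f t) = |s - t|
  cn : ∀ x y z m, d y m = d y z / 2 → d m z = d y z / 2 →
    d x m ^ 2 ≤ (d x y ^ 2 + d x z ^ 2) / 2 - d y z ^ 2 / 4

/-- A 2-cell of the core of a product of two simplicial trees: a rectangle which is a
product of two edges and is contained in the core. -/
def IsCoreCell (G : Type*) {T₁ T₂ : Type*} [Group G] [MetricSpace T₁] [MetricSpace T₂]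
    [MulAction G T₁] [MulAction G T₂] (V₁ : Set T₁) (V₂ : Set T₂)
    (R : Set (T₁ × T₂)) : Prop :=
  ∃ v₁ w₁ v₂ w₂, Adjacent V₁ v₁ w₁ ∧ Adjacent V₂ v₂ w₂ ∧
    R = seg v₁ w₁ ×ˢ seg v₂ w₂ ∧ R ⊆ Core G T₁ T₂


/-! ### Segments, medians and the four-point condition -/

section Segments

variable {T : Type*} [MetricSpace T]

lemma mem_seg {x y p : T} : p ∈ seg x y ↔ dist x p + dist p y = dist x y := Iff.rfl

lemma seg_comm (x y : T) : seg x y = seg y x := by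
  ext p
  rw [mem_seg, mem_seg, dist_comm x p, dist_comm p y, dist_comm x y, add_comm]

lemma left_mem_seg (x y : T) : x ∈ seg x y := by simp [mem_seg]

lemma right_mem_seg (x y : T) : y ∈ seg x y := by simp [mem_seg]

lemma mem_seg_of_mem_seg_left {x y m p : T} (hm : m ∈ seg x y) (hp : p ∈ seg x m) :
    p ∈ seg x y := by
  rw [mem_seg] at *
  linarith [dist_triangle p m y, dist_triangle x p y]

lemma mem_seg_of_mem_seg_right {x y m p : T} (hm : m ∈ seg x y) (hp : p ∈ seg m y) :
    p ∈ seg x y := by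
  rw [seg_comm] at *
  exact mem_seg_of_mem_seg_left hm hp

/-- A concatenation of two injective paths meeting only at the junction is injective. -/
lemma path_trans_injective {x m y : T} {γ : Path x m} {γ' : Path m y}
    (hγ : Injective γ) (hγ' : Injective γ') (h : ∀ s t, γ s = γ' t → t = 0) :
    Injective (γ.trans γ') := by
  intro s t hst
  rw [Path.trans_apply, Path.trans_apply] at hst
  split_ifs at hst with hs ht ht
  · have := congrArg Subtype.val (hγ hst)
    ext
    simp only at this
    linarith
  · have := congrArg Subtype.val (h _ _ hst)
    simp only [Icc.coe_zero] at this
    exact absurd (show (t : ℝ) ≤ 1 / 2 by linarith) ht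
  · have := congrArg Subtype.val (h _ _ hst.symm)
    simp only [Icc.coe_zero] at this
    exact absurd (show (s : ℝ) ≤ 1 / 2 by linarith) hs
  · have := congrArg Subtype.val (hγ' hst)
    ext
    simp only at this
    linarith

lemma IsRTree.exists_path (hT : IsRTree T) (x y : T) : ∃ γ : Path x y,
    (x ≠ y → Injective γ) ∧ (∀ t, dist x (γ t) = t * dist x y) ∧ ∀ t, γ t ∈ seg x y := by
  obtain ⟨f, h0, h1, hf⟩ := hT.exists_geod x y
  have hd : 0 ≤ dist x y := dist_nonneg
  have hmem : ∀ t : unitInterval, (t : ℝ) * dist x y ∈ Icc (0 : ℝ) (dist x y) := fun t =>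
    ⟨mul_nonneg t.2.1 hd, mul_le_of_le_one_left hd t.2.2⟩
  have hdist : ∀ s t : unitInterval,
      dist (f (s * dist x y)) (f (t * dist x y)) = dist x y * dist s t := by
    intro s t
    rw [hf _ (hmem s) _ (hmem t), ← sub_mul, abs_mul, abs_of_nonneg hd, mul_comm,
      Subtype.dist_eq, Real.dist_eq]
  have hl : ∀ t : unitInterval, dist x (f (t * dist x y)) = t * dist x y := by
    intro t
    have := hf 0 ⟨le_rfl, hd⟩ _ (hmem t)
    rwa [h0, zero_sub, abs_neg, abs_of_nonneg (hmem t).1] at this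
  have hr : ∀ t : unitInterval, dist (f (t * dist x y)) y = dist x y - t * dist x y := by
    intro t
    have := hf _ (hmem t) _ ⟨hd, le_rfl⟩
    rwa [h1, abs_sub_comm, abs_of_nonneg (sub_nonneg.2 (hmem t).2)] at this
  refine ⟨⟨⟨fun t => f (t * dist x y), ?_⟩, by simp [h0], by simp [h1]⟩, ?_, hl, ?_⟩
  · refine (LipschitzWith.of_dist_le_mul (K := ⟨dist x y, hd⟩) fun s t => ?_).continuous
    exact (hdist s t).le
  · intro hxy s t hst
    have h2 := hdist s t
    rw [show f (s * dist x y) = f (t * dist x y) from hst, dist_self] at h2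
    exact dist_eq_zero.1 ((mul_eq_zero.1 h2.symm).resolve_left (dist_ne_zero.2 hxy))
  · intro t
    change dist x (f (t * dist x y)) + dist (f (t * dist x y)) y = dist x y
    rw [hl, hr]
    ring

lemma IsRTree.exists_mem_seg (hT : IsRTree T) {x y : T} {r : ℝ} (h0 : 0 ≤ r)
    (h1 : r ≤ dist x y) : ∃ p ∈ seg x y, dist x p = r := by
  rcases eq_or_ne x y with rfl | hxy
  · rw [dist_self] at h1
    exact ⟨x, left_mem_seg x x, by rw [dist_self]; linarith⟩
  · obtain ⟨γ, -, hd, hs⟩ := hT.exists_path x y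
    have hpos : 0 < dist x y := dist_pos.2 hxy
    exact ⟨γ ⟨r / dist x y, by positivity, (div_le_one hpos).2 h1⟩, hs _, by
      rw [hd]; exact div_mul_cancel₀ r hpos.ne'⟩

/-- A point separating two segments lies on every arc between their other endpoints. -/
lemma IsRTree.mem_range_of_inter (hT : IsRTree T) {x m y : T} (hx : x ≠ m) (hy : m ≠ y)
    (h : ∀ p ∈ seg x m, p ∈ seg m y → p = m) (γ : Path x y) (hγ : Injective γ) :
    m ∈ range γ := by
  obtain ⟨γ₁, hi₁, -, hs₁⟩ := hT.exists_path x m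
  obtain ⟨γ₂, hi₂, -, hs₂⟩ := hT.exists_path m y
  have hinj : Injective (γ₁.trans γ₂) := by
    refine path_trans_injective (hi₁ hx) (hi₂ hy) fun s t hst => hi₂ hy ?_
    rw [γ₂.source]
    exact h _ (hst ▸ hs₁ s) (hs₂ t)
  rw [← hT.arc_unique x y _ _ hinj hγ, Path.trans_range]
  exact Or.inl ⟨1, γ₁.target⟩

lemma IsRTree.mem_range_of_mem_seg (hT : IsRTree T) {x y p : T} (hp : p ∈ seg x y)
    (γ : Path x y) (hγ : Injective γ) : p ∈ range γ := by
  rcases eq_or_ne x p with rfl | hx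
  · exact ⟨0, γ.source⟩
  rcases eq_or_ne p y with rfl | hy
  · exact ⟨1, γ.target⟩
  refine hT.mem_range_of_inter hx hy (fun q hq hq' => ?_) γ hγ
  rw [mem_seg] at *
  refine dist_le_zero.1 ?_
  linarith [dist_triangle x q y, dist_comm p q]

lemma IsRTree.eq_of_mem_seg (hT : IsRTree T) {x y p q : T} (hp : p ∈ seg x y)
    (hq : q ∈ seg x y) (h : dist x p = dist x q) : p = q := by
  rcases eq_or_ne x y with rfl | hxy
  · rw [mem_seg, dist_self] at hp hq
    have hxp : x = p := dist_le_zero.1 (by linarith [@dist_nonneg _ _ p x])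
    have hxq : x = q := dist_le_zero.1 (by linarith [@dist_nonneg _ _ q x])
    rw [← hxp, ← hxq]
  · obtain ⟨γ, hi, hd, -⟩ := hT.exists_path x y
    obtain ⟨s, rfl⟩ := hT.mem_range_of_mem_seg hp γ (hi hxy)
    obtain ⟨t, rfl⟩ := hT.mem_range_of_mem_seg hq γ (hi hxy)
    rw [hd, hd] at h
    rw [Subtype.ext (mul_right_cancel₀ (dist_ne_zero.2 hxy) h)]

lemma IsRTree.isCompact_seg (hT : IsRTree T) (x y : T) : IsCompact (seg x y) := by
  rcases eq_or_ne x y with rfl | hxy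
  · have : seg x x = {x} := by
      ext p
      rw [mem_seg, dist_self, dist_comm p x, mem_singleton_iff, ← two_mul,
        mul_eq_zero_iff_left two_ne_zero, dist_eq_zero, eq_comm]
    rw [this]
    exact isCompact_singleton
  · obtain ⟨γ, hi, -, hs⟩ := hT.exists_path x y
    have : seg x y = range γ :=
      Subset.antisymm (fun p hp => hT.mem_range_of_mem_seg hp γ (hi hxy))
        (range_subset_iff.2 hs)
    rw [this]
    exact isCompact_range γ.continuous

lemma IsRTree.isPreconnected_seg (hT : IsRTree T) (x y : T) : IsPreconnected (seg x y) := by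
  rcases eq_or_ne x y with rfl | hxy
  · refine Set.Subsingleton.isPreconnected fun p hp q hq => ?_
    refine hT.eq_of_mem_seg hp hq ?_
    rw [mem_seg, dist_self] at hp hq
    linarith [dist_comm p x, dist_comm q x]
  · obtain ⟨γ, hi, -, hs⟩ := hT.exists_path x y
    have : seg x y = range γ :=
      Subset.antisymm (fun p hp => hT.mem_range_of_mem_seg hp γ (hi hxy))
        (range_subset_iff.2 hs)
    rw [this]
    exact isPreconnected_range γ.continuous

/-- A nearest-point projection to a segment lies on the segments to its endpoints. -/
lemma IsRTree.mem_seg_of_isMinOn (hT : IsRTree T) {x y z m : T} (hm : m ∈ seg x y)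
    (hmin : ∀ p ∈ seg x y, dist z m ≤ dist z p) : m ∈ seg z y := by
  rcases eq_or_ne z m with rfl | hz
  · exact left_mem_seg z y
  rcases eq_or_ne m y with rfl | hy
  · exact right_mem_seg z m
  have hint : ∀ p ∈ seg z m, p ∈ seg m y → p = m := by
    intro p hp hp'
    have := hmin p (mem_seg_of_mem_seg_right hm hp')
    rw [mem_seg] at hp
    exact dist_le_zero.1 (by linarith)
  have hzy : z ≠ y := by
    rintro rfl
    exact hz (hint z (left_mem_seg z m) (right_mem_seg m z))
  obtain ⟨γ, hi, -, hs⟩ := hT.exists_path z y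
  obtain ⟨t, rfl⟩ := hT.mem_range_of_inter hz hy hint γ (hi hzy)
  exact hs t

lemma IsRTree.exists_median (hT : IsRTree T) (x y z : T) :
    ∃ m, m ∈ seg x y ∧ m ∈ seg z x ∧ m ∈ seg z y := by
  obtain ⟨m, hm, hmin⟩ := (hT.isCompact_seg x y).exists_isMinOn ⟨x, left_mem_seg x y⟩
    (continuous_const.dist continuous_id : Continuous fun p => dist z p).continuousOn
  refine ⟨m, hm, ?_, hT.mem_seg_of_isMinOn hm hmin⟩
  rw [seg_comm] at hm
  exact hT.mem_seg_of_isMinOn hm fun p hp => hmin (by rwa [seg_comm])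

lemma IsRTree.mem_seg_of_dist_le (hT : IsRTree T) {x y m p : T} (hm : m ∈ seg x y)
    (hp : p ∈ seg x y) (h : dist x p ≤ dist x m) : p ∈ seg x m := by
  obtain ⟨q, hq, hd⟩ := hT.exists_mem_seg dist_nonneg h
  rwa [hT.eq_of_mem_seg hp (mem_seg_of_mem_seg_left hm hq) hd.symm]

/-- Geodesic triangles are tripods. -/
lemma IsRTree.seg_subset_union (hT : IsRTree T) (x y z : T) :
    seg x z ⊆ seg x y ∪ seg y z := by
  intro p hp
  obtain ⟨m, hxz, hyx, hyz⟩ := hT.exists_median x z y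
  rcases le_total (dist x p) (dist x m) with h | h
  · left
    rw [seg_comm] at hyx
    exact mem_seg_of_mem_seg_left hyx (hT.mem_seg_of_dist_le hxz hp h)
  · right
    have h' : dist z p ≤ dist z m := by
      rw [mem_seg] at hp hxz
      linarith [dist_comm z p, dist_comm z m]
    rw [seg_comm] at hxz hp hyz ⊢
    exact mem_seg_of_mem_seg_left hyz (hT.mem_seg_of_dist_le hxz hp h')

/-- The four-point condition, in terms of (doubled) Gromov products. -/
lemma IsRTree.min_gromov_le (hT : IsRTree T) (w x y z : T) :
    min (dist w x + dist w y - dist x y) (dist w y + dist w z - dist y z) ≤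
      dist w x + dist w z - dist x z := by
  obtain ⟨n, hxz, hwx, hwz⟩ := hT.exists_median x z w
  rw [min_le_iff]
  rcases hT.seg_subset_union x y z hxz with h | h
  · left
    rw [mem_seg] at *
    linarith [dist_triangle w n y, dist_comm x n]
  · right
    rw [mem_seg] at *
    linarith [dist_triangle w n y, dist_comm x n, dist_comm n y]

lemma IsRTree.dist_of_mem_seg (hT : IsRTree T) {x y p r : T} (hp : p ∈ seg x y)
    (hr : r ∈ seg x y) (h : dist x p ≤ dist x r) : dist p r = dist x r - dist x p := by
  have := hT.mem_seg_of_dist_le hr hp h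
  rw [mem_seg] at this
  linarith

end Segments

/-! ### Directions -/

section Directions

variable {T : Type*} [MetricSpace T]

lemma mem_component_of_isPreconnected {x y p q : T} {S : Set T} (hS : IsPreconnected S)
    (hx : x ∉ S) (hp : p ∈ S) (hq : q ∈ S) (hpy : p ∈ connectedComponentIn {x}ᶜ y) :
    q ∈ connectedComponentIn {x}ᶜ y := by
  rw [connectedComponentIn_eq hpy]
  exact hS.subset_connectedComponentIn hp (subset_compl_singleton_iff.2 hx) hq

lemma IsRTree.isOpen_direction (hT : IsRTree T) {δ : Set T} (hδ : IsDirection δ) :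
    IsOpen δ := by
  obtain ⟨x, y, -, rfl⟩ := hδ
  rw [Metric.isOpen_iff]
  intro p hp
  have hpx : p ≠ x := connectedComponentIn_subset _ _ hp
  refine ⟨dist p x, dist_pos.2 hpx, fun q hq => ?_⟩
  refine mem_component_of_isPreconnected (hT.isPreconnected_seg p q) (fun hx => ?_)
    (left_mem_seg p q) (right_mem_seg p q) hp
  rw [mem_seg] at hx
  rw [mem_ball, dist_comm] at hq
  linarith [@dist_nonneg _ _ x q]

lemma IsRTree.treeConvex_compl_direction (hT : IsRTree T) {δ : Set T} (hδ : IsDirection δ) :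
    TreeConvex δᶜ := by
  obtain ⟨x, y, -, rfl⟩ := hδ
  intro u hu v hv p hp hpδ
  have key : ∀ q, q ∉ connectedComponentIn {x}ᶜ y → x ∈ seg p q := by
    intro q hq
    by_contra hx
    exact hq (mem_component_of_isPreconnected (hT.isPreconnected_seg p q) hx
      (left_mem_seg p q) (right_mem_seg p q) hpδ)
  have hpx : p ≠ x := connectedComponentIn_subset _ _ hpδ
  have h1 := key u hu
  have h2 := key v hv
  rw [mem_seg] at hp h1 h2
  linarith [dist_pos.2 hpx, dist_triangle u x v, dist_comm u p, dist_comm u x]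

/-- If the minimal subtree is dense, every orbit meets every direction. -/
lemma IsRTree.exists_smul_mem_direction {G : Type*} [Group G] [MulAction G T]
    (hT : IsRTree T) (hiso : IsometricAction G T) (hdense : Dense (minSubtree G T))
    {δ : Set T} (hδ : IsDirection δ) (p : T) : ∃ g : G, g • p ∈ δ := by
  by_contra! hp
  let S : Set T := {q | ∀ g : G, g • q ∈ δᶜ}
  have hS : S ∈ {S : Set T | S.Nonempty ∧ TreeConvex S ∧
      ∀ g ∈ (univ : Set G), ∀ x ∈ S, g • x ∈ S} := by
    refine ⟨⟨p, hp⟩, fun u hu v hv q hq g => ?_, fun g _ q hq k => ?_⟩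
    · refine hT.treeConvex_compl_direction hδ _ (hu g) _ (hv g) ?_
      rw [mem_seg] at *
      rwa [hiso, hiso, hiso]
    · rw [smul_smul]
      exact hq _
  have hne : δ.Nonempty := by
    obtain ⟨x, y, hy, rfl⟩ := hδ
    exact ⟨y, mem_connectedComponentIn hy⟩
  obtain ⟨q, hqδ, hq⟩ := hdense.inter_open_nonempty δ (hT.isOpen_direction hδ) hne
  have := sInter_subset_of_mem hS hq 1
  rw [one_smul] at this
  exact this hqδ

end Directions

/-! ### Hyperbolic isometries -/

lemma Hyperbolic.inv {G T : Type*} [Group G] [MulAction G T]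
    {g : G} (hg : Hyperbolic T g) : Hyperbolic T g⁻¹ :=
  fun x hx => hg x (inv_smul_eq_iff.1 hx).symm

lemma Hyperbolic.conj {G T : Type*} [Group G] [MulAction G T]
    {g : G} (hg : Hyperbolic T g) (k : G) :
    Hyperbolic T (k * g * k⁻¹) := by
  intro x hx
  apply hg (k⁻¹ • x)
  rw [eq_inv_smul_iff, smul_smul, smul_smul]
  exact hx

lemma Hyperbolic.mul_comm {G T : Type*} [Group G] [MulAction G T]
    {a b : G} (h : Hyperbolic T (a * b)) : Hyperbolic T (b * a) := by
  have := h.conj b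
  rwa [← mul_assoc, mul_inv_cancel_right] at this

section Isometries

variable {G T : Type*} [Group G] [MetricSpace T] [MulAction G T]

lemma IsometricAction.dist_inv_smul (hiso : IsometricAction G T) (g : G) (x y : T) :
    dist (g⁻¹ • x) y = dist x (g • y) := by
  rw [← hiso g, smul_inv_smul]

lemma Hyperbolic.dist_lt (hT : IsRTree T) (hiso : IsometricAction G T) {g : G}
    (hg : Hyperbolic T g) (p : T) : dist p (g • p) < dist p (g • g • p) := by
  by_contra! hle
  obtain ⟨m, hm, hd⟩ := hT.exists_mem_seg (x := p) (y := g • p)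
    (r := dist p (g • p) / 2) (by positivity) (by linarith [@dist_nonneg _ _ p (g • p)])
  obtain ⟨n, hn, hn1, hn2⟩ := hT.exists_median p (g • g • p) (g • p)
  have e1 := hiso g p (g • p)
  have e2 := hiso g p m
  have e3 := hiso g m (g • p)
  apply hg m
  have hgm : g • m ∈ seg (g • p) (g • g • p) := by
    rw [mem_seg] at *
    rw [hiso, hiso, hiso]
    exact hm
  rw [seg_comm] at hm
  have c1 : dist (g • p) m ≤ dist (g • p) n := by
    rw [mem_seg] at *
    linarith [dist_comm p n, dist_comm p (g • p), dist_comm (g • p) m, dist_comm m p]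
  have m1 := mem_seg.1 hm
  have m2 := mem_seg.1 hgm
  have c2 : dist (g • p) (g • m) = dist (g • p) m := by
    linarith [dist_comm p (g • p), dist_comm m p]
  exact hT.eq_of_mem_seg (hT.mem_seg_of_dist_le hn2 hgm (c2.trans_le c1))
    (hT.mem_seg_of_dist_le hn1 hm c1) c2

lemma hyperbolic_of_dist_lt (hT : IsRTree T) (hiso : IsometricAction G T) {g : G} {p : T}
    (h : dist p (g • p) < dist p (g • g • p)) : Hyperbolic T g := by
  intro x hx
  have e1 := hiso g x p
  have e2 := hiso g x (g • p)
  have e3 := hiso g p (g • p)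
  rw [hx] at e1 e2
  rcases min_le_iff.1 (hT.min_gromov_le x p (g • p) (g • g • p)) with h' | h' <;> linarith

/-- A hyperbolic isometry has a point `p` lying midway between its two translates. -/
lemma Hyperbolic.exists_mem_axis (hT : IsRTree T) (hiso : IsometricAction G T) {g : G}
    (hg : Hyperbolic T g) (q : T) : ∃ p : T, dist p (g • g • p) = 2 * dist p (g • p) := by
  obtain ⟨p, hp, hp1, hp2⟩ := hT.exists_median (g⁻¹ • q) (g • q) q
  have e1 := hiso.dist_inv_smul g q q
  have e2 := hiso.dist_inv_smul g q (g • q)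
  have e3 := hiso.dist_inv_smul g q p
  have e4 := hiso g q p
  have e5 := hiso g p (g • p)
  have e6 := hiso g (g • q) (g • p)
  have hlt := hg.dist_lt hT hiso q
  have hgp : g • p ∈ seg q (g • q) := by
    rw [mem_seg] at *
    linarith [dist_comm q (g⁻¹ • q), dist_comm p (g⁻¹ • q), dist_comm (g • p) (g • q)]
  have m1 := mem_seg.1 hp
  have m2 := mem_seg.1 hp1
  have m3 := mem_seg.1 hp2
  have m4 := mem_seg.1 hgp
  have hle : dist q p ≤ dist q (g • p) := by
    linarith [dist_comm q (g⁻¹ • q), dist_comm p (g⁻¹ • q), dist_comm (g • p) (g • q)]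
  have hd := hT.dist_of_mem_seg hp2 hgp hle
  refine ⟨p, le_antisymm ?_ ?_⟩
  · linarith [dist_triangle p (g • p) (g • g • p)]
  · linarith [dist_triangle q p (g • g • q), dist_triangle p (g • g • p) (g • g • q),
      dist_comm q (g⁻¹ • q), dist_comm p (g⁻¹ • q), dist_comm (g • p) (g • q),
      dist_comm (g • g • p) (g • g • q)]

lemma dist_pow_smul (hT : IsRTree T) (hiso : IsometricAction G T) {g : G}
    (hg : Hyperbolic T g) {p : T} (hp : dist p (g • g • p) = 2 * dist p (g • p)) (n : ℕ) :
    dist p (g ^ n • p) = n * dist p (g • p) := by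
  have hpos : 0 < dist p (g • p) := dist_pos.2 (hg p).symm
  induction n with
  | zero => simp
  | succ n ih =>
    rcases Nat.eq_zero_or_pos n with rfl | hn
    · simp
    obtain ⟨k, rfl⟩ := Nat.exists_eq_succ_of_ne_zero hn.ne'
    have e1 : dist (g ^ (k + 1) • p) (g ^ (k + 2) • p) = dist p (g • p) := by
      rw [pow_succ g (k + 1), mul_smul, hiso]
    have e2 : dist (g ^ k • p) (g ^ (k + 1) • p) = dist p (g • p) := by
      rw [pow_succ g k, mul_smul, hiso]
    have e3 : dist (g ^ k • p) (g ^ (k + 2) • p) = 2 * dist p (g • p) := by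
      rw [pow_add g k 2, mul_smul, hiso, pow_two, mul_smul, hp]
    have e4 : dist p (g ^ k • p) ≤ k * dist p (g • p) := by
      clear ih hn e1 e2 e3
      induction k with
      | zero => simp
      | succ k ih =>
        have : dist (g ^ k • p) (g ^ (k + 1) • p) = dist p (g • p) := by
          rw [pow_succ g k, mul_smul, hiso]
        push_cast
        linarith [dist_triangle p (g ^ k • p) (g ^ (k + 1) • p)]
    have h4 := hT.min_gromov_le (g ^ (k + 1) • p) (g ^ k • p) p (g ^ (k + 2) • p)
    simp only [Nat.succ_eq_add_one] at *
    push_cast at *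
    have c1 := dist_comm (g ^ (k + 1) • p) (g ^ k • p)
    have c2 := dist_comm (g ^ (k + 1) • p) p
    have c3 := dist_comm (g ^ k • p) p
    have tri := dist_triangle p (g ^ (k + 1) • p) (g ^ (k + 2) • p)
    rw [show k + 1 + 1 = k + 2 from rfl]
    rcases min_le_iff.1 h4 with h' | h'
    · linarith
    · linarith

lemma dist_zpow_smul (hT : IsRTree T) (hiso : IsometricAction G T) {g : G}
    (hg : Hyperbolic T g) {p : T} (hp : dist p (g • g • p) = 2 * dist p (g • p)) {i j : ℤ}
    (hij : i ≤ j) : dist (g ^ i • p) (g ^ j • p) = (j - i) * dist p (g • p) := by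
  obtain ⟨n, rfl⟩ := Int.le.dest hij
  rw [zpow_add, mul_smul, hiso, zpow_natCast, dist_pow_smul hT hiso hg hp]
  push_cast
  ring

/-- A hyperbolic isometry translates along a geodesic line. -/
lemma Hyperbolic.exists_line (hT : IsRTree T) (hiso : IsometricAction G T) {g : G}
    (hg : Hyperbolic T g) (q : T) : ∃ (ℓ : ℝ) (F : ℝ → T), 0 < ℓ ∧
      (∀ s t, dist (F s) (F t) = |s - t|) ∧ ∀ t, g • F t = F (t + ℓ) := by
  obtain ⟨p, hp⟩ := hg.exists_mem_axis hT hiso q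
  obtain ⟨f, h0, h1, hf⟩ := hT.exists_geod p (g • p)
  set ℓ := dist p (g • p) with hℓ
  have hpos : 0 < ℓ := dist_pos.2 (hg p).symm
  let F : ℝ → T := fun t => g ^ ⌊t / ℓ⌋ • f (t - ⌊t / ℓ⌋ * ℓ)
  have hmem : ∀ t : ℝ, t - ⌊t / ℓ⌋ * ℓ ∈ Icc 0 ℓ := fun t => by
    have h2 := (le_div_iff₀ hpos).1 (Int.floor_le (t / ℓ))
    have h3 := (div_lt_iff₀ hpos).1 (Int.lt_floor_add_one (t / ℓ))
    constructor <;> linarith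
  have hleft : ∀ t, dist (g ^ ⌊t / ℓ⌋ • p) (F t) = t - ⌊t / ℓ⌋ * ℓ := fun t => by
    have := hf 0 ⟨le_rfl, hpos.le⟩ _ (hmem t)
    rw [h0, zero_sub, abs_neg, abs_of_nonneg (hmem t).1] at this
    rw [hiso, this]
  have hright : ∀ t, dist (F t) (g ^ (⌊t / ℓ⌋ + 1) • p) = (⌊t / ℓ⌋ + 1) * ℓ - t :=
    fun t => by
    have := hf _ (hmem t) ℓ ⟨hpos.le, le_rfl⟩
    rw [h1, abs_sub_comm, abs_of_nonneg (sub_nonneg.2 (hmem t).2)] at this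
    rw [zpow_add, mul_smul, hiso, zpow_one, this]
    ring
  have hle : ∀ s t, s ≤ t → dist (F s) (F t) = t - s := by
    intro s t hst
    have hfl : ⌊s / ℓ⌋ ≤ ⌊t / ℓ⌋ := Int.floor_mono (by gcongr)
    rcases hfl.eq_or_lt with h | h
    · have := hf _ (hmem s) _ (hmem t)
      rw [h] at this
      change dist (g ^ ⌊s / ℓ⌋ • f _) (g ^ ⌊t / ℓ⌋ • f _) = _
      rw [h, hiso, this, abs_sub_comm, abs_of_nonneg (by linarith)]
      ring
    · have a1 := dist_zpow_smul hT hiso hg hp (show ⌊s / ℓ⌋ ≤ ⌊t / ℓ⌋ + 1 by omega)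
      have a2 := dist_zpow_smul hT hiso hg hp (show ⌊s / ℓ⌋ + 1 ≤ ⌊t / ℓ⌋ by omega)
      push_cast at a1 a2
      rw [← hℓ] at a1 a2
      have b1 := hleft s
      have b2 := hleft t
      have b3 := hright s
      have b4 := hright t
      have t1 := dist_triangle4 (F s) (g ^ (⌊s / ℓ⌋ + 1) • p) (g ^ ⌊t / ℓ⌋ • p) (F t)
      have t2 := dist_triangle4 (g ^ ⌊s / ℓ⌋ • p) (F s) (F t) (g ^ (⌊t / ℓ⌋ + 1) • p)
      apply le_antisymm <;> linarith
  refine ⟨ℓ, F, hpos, fun s t => ?_, fun t => ?_⟩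
  · rcases le_total s t with h | h
    · rw [hle s t h, abs_sub_comm, abs_of_nonneg (sub_nonneg.2 h)]
    · rw [dist_comm, hle t s h, abs_of_nonneg (sub_nonneg.2 h)]
  · have : ⌊(t + ℓ) / ℓ⌋ = ⌊t / ℓ⌋ + 1 := by
      rw [add_div, div_self hpos.ne', Int.floor_add_one]
    change g • g ^ ⌊t / ℓ⌋ • f _ = g ^ ⌊(t + ℓ) / ℓ⌋ • f _
    rw [this, smul_smul, add_comm ⌊t / ℓ⌋ 1, zpow_add, zpow_one]
    congr 2
    push_cast
    ring

/-- Points on a translated line minimize the displacement. -/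
lemma mem_axisSet_of_line (hiso : IsometricAction G T) {g : G} {ℓ : ℝ} {F : ℝ → T}
    (hℓ : 0 < ℓ) (hF : ∀ s t, dist (F s) (F t) = |s - t|) (hg : ∀ t, g • F t = F (t + ℓ))
    (t : ℝ) : F t ∈ axisSet T g := by
  intro y
  have hd : ∀ (n : ℕ), g ^ n • F t = F (t + n * ℓ) := by
    intro n
    induction n with
    | zero => simp
    | succ n ih =>
      rw [pow_succ', mul_smul, ih, hg]
      congr 1
      push_cast
      ring
  have hy : ∀ n : ℕ, dist y (g ^ n • y) ≤ n * dist y (g • y) := by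
    intro n
    induction n with
    | zero => simp
    | succ n ih =>
      have : dist (g ^ n • y) (g ^ (n + 1) • y) = dist y (g • y) := by
        rw [pow_succ, mul_smul, hiso]
      push_cast
      linarith [dist_triangle y (g ^ n • y) (g ^ (n + 1) • y)]
  rw [hg, hF, show t - (t + ℓ) = -ℓ by ring, abs_neg, abs_of_pos hℓ]
  by_contra! hlt
  obtain ⟨n, hn⟩ := exists_nat_gt (2 * dist (F t) y / (ℓ - dist y (g • y)))
  rw [div_lt_iff₀ (by linarith)] at hn
  have h1 : dist (F t) (g ^ n • F t) = n * ℓ := by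
    rw [hd, hF, show t - (t + n * ℓ) = -(n * ℓ) by ring, abs_neg, abs_of_nonneg (by positivity)]
  have h2 := dist_triangle4 (F t) y (g ^ n • y) (g ^ n • F t)
  rw [hiso, dist_comm y (F t)] at h2
  nlinarith [hy n]

lemma posSemiAxis_of_line (hiso : IsometricAction G T) {g : G} {ℓ : ℝ} {F : ℝ → T}
    (hℓ : 0 < ℓ) (hF : ∀ s t, dist (F s) (F t) = |s - t|) (hg : ∀ t, g • F t = F (t + ℓ)) :
    PosSemiAxis T g (F '' Ici 0) := by
  refine ⟨⟨F, fun s _ t _ => hF s t, rfl⟩, ?_, ?_⟩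
  · rintro _ ⟨t, -, rfl⟩
    exact mem_axisSet_of_line hiso hℓ hF hg t
  · rintro _ ⟨_, ⟨t, ht, rfl⟩, rfl⟩
    exact ⟨t + ℓ, add_nonneg ht hℓ.le, (hg t).symm⟩

/-- If a point of a translated line lies in a direction, then one of the two half-lines
issued from it is a semi-axis contained in this direction. -/
lemma exists_semiaxis_of_line (hiso : IsometricAction G T) {g : G} {ℓ : ℝ} {F : ℝ → T}
    (hℓ : 0 < ℓ) (hF : ∀ s t, dist (F s) (F t) = |s - t|) (hg : ∀ t, g • F t = F (t + ℓ))
    {δ : Set T} (hδ : IsDirection δ) (h0 : F 0 ∈ δ) :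
    EndInSubtree T g δ ∨ EndInSubtree T g⁻¹ δ := by
  obtain ⟨x, y, -, rfl⟩ := hδ
  have key : ∀ F : ℝ → T, (∀ s t, dist (F s) (F t) = |s - t|) →
      F 0 ∈ connectedComponentIn {x}ᶜ y → x ∉ F '' Ici 0 →
      F '' Ici 0 ⊆ connectedComponentIn {x}ᶜ y := by
    intro F hF h0 hx q hq
    have hcont : Continuous F :=
      (Isometry.of_dist_eq fun s t => (hF s t).trans (Real.dist_eq s t).symm).continuous
    exact mem_component_of_isPreconnected (isPreconnected_Ici.image F hcont.continuousOn) hx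
      ⟨0, self_mem_Ici, rfl⟩ hq h0
  by_cases hx : x ∈ F '' Ici 0
  · right
    have hF' : ∀ s t, dist (F (-s)) (F (-t)) = |s - t| := fun s t => by
      rw [hF, ← abs_neg]
      congr 1
      ring
    refine ⟨_, posSemiAxis_of_line (F := fun t => F (-t)) hiso hℓ hF' fun t => ?_,
      key (fun t => F (-t)) hF' (by simpa using h0) ?_⟩
    · rw [inv_smul_eq_iff, hg]
      congr 1
      ring
    · rintro ⟨t, ht, htx⟩
      obtain ⟨s, hs, rfl⟩ := hx
      have := hF (-t) s
      rw [show F (-t) = F s from htx, dist_self, eq_comm, abs_eq_zero] at this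
      have hs0 : s = 0 := by
        rw [mem_Ici] at hs ht
        linarith
      subst hs0
      exact connectedComponentIn_subset _ _ h0 rfl
  · exact Or.inl ⟨_, posSemiAxis_of_line hiso hℓ hF hg, key F hF h0 hx⟩

/-- If `a` is hyperbolic and `b` is elliptic, then one of `b`, `b²` has hyperbolic products
with both `a` and `a²`. -/
lemma Hyperbolic.mul_elliptic (hT : IsRTree T) (hiso : IsometricAction G T) {a b : G}
    (ha : Hyperbolic T a) (hb : Elliptic T b) :
    (Hyperbolic T (a * b) ∧ Hyperbolic T (a ^ 2 * b)) ∨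
      (Hyperbolic T (a * b ^ 2) ∧ Hyperbolic T (a ^ 2 * b ^ 2)) := by
  obtain ⟨o, ho⟩ := hb
  let P : T → T → Prop := fun x y => dist o (a • o) ≤ dist o x + dist o y - dist x y
  have hlt := ha.dist_lt hT hiso o
  have symm : ∀ {x y}, P x y → P y x := fun {x y} h => by
    change _ ≤ _
    linarith [show dist o (a • o) ≤ dist o x + dist o y - dist x y from h, dist_comm x y]
  have trans : ∀ {x y z}, P x y → P y z → P x z := fun {x y z} h h' =>
    (le_min h h').trans (hT.min_gromov_le o x y z)
  have hPsmul : ∀ {c : G}, c • o = o → ∀ {x y}, P x y → P (c • x) (c • y) := by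
    intro c hc x y h
    change _ ≤ _
    have e1 := hiso c o x
    have e2 := hiso c o y
    rw [hc] at e1 e2
    rw [e1, e2, hiso]
    exact h
  have i1 : dist o (a⁻¹ • o) = dist o (a • o) := by rw [dist_comm, hiso.dist_inv_smul]
  have i2 : dist o (a⁻¹ • a⁻¹ • o) = dist o (a • a • o) := by
    rw [dist_comm, hiso.dist_inv_smul, hiso.dist_inv_smul]
  have hv : P (a • o) (a • a • o) := by
    change _ ≤ _
    rw [hiso]
    linarith
  have hu : P (a⁻¹ • o) (a⁻¹ • a⁻¹ • o) := by
    change _ ≤ _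
    rw [hiso, i1, i2]
    linarith
  have huv : ¬ P (a⁻¹ • o) (a • o) := by
    change ¬ (_ ≤ _)
    rw [hiso.dist_inv_smul, i1]
    linarith
  have step : ∀ c : G, c • o = o → ¬ (Hyperbolic T (a * c) ∧ Hyperbolic T (a ^ 2 * c)) →
      P (a⁻¹ • o) (c • a • o) := by
    intro c hc h
    rcases not_and_or.1 h with h | h
    · have hle := not_lt.1 fun hl => h (hyperbolic_of_dist_lt (p := o) hT hiso hl)
      rw [mul_smul a c o, hc, mul_smul] at hle
      change _ ≤ _
      have := hiso c o (a • o)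
      rw [hc] at this
      rw [hiso.dist_inv_smul, i1]
      linarith
    · have hle := not_lt.1 fun hl => h (hyperbolic_of_dist_lt (p := o) hT hiso hl)
      rw [mul_smul (a ^ 2) c o, hc, mul_smul, pow_two, mul_smul, mul_smul] at hle
      have h2 : P (a⁻¹ • a⁻¹ • o) (c • a • a • o) := by
        change _ ≤ _
        have := hiso c o (a • a • o)
        rw [hc] at this
        rw [hiso.dist_inv_smul, hiso.dist_inv_smul, i2]
        linarith
      exact trans (trans hu h2) (symm (hPsmul hc hv))
  by_contra h
  rw [not_or] at h
  have h1 := step b ho h.1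
  have h2 := step (b ^ 2) (by rw [pow_two, mul_smul, ho, ho]) h.2
  rw [pow_two, mul_smul] at h2
  have h3 := hPsmul (c := b⁻¹) (inv_smul_eq_iff.2 ho.symm) (trans (symm h1) h2)
  rw [inv_smul_smul, inv_smul_smul] at h3
  exact huv (trans h1 (symm h3))

end Isometries

/-- Two non-trivial actions on `ℝ`-trees have a common hyperbolic element. -/
lemma exists_hyperbolic_hyperbolic {G T₁ T₂ : Type*} [Group G] [MetricSpace T₁]
    [MetricSpace T₂] [MulAction G T₁] [MulAction G T₂]
    (hT₁ : IsRTree T₁) (hT₂ : IsRTree T₂)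
    (hiso₁ : IsometricAction G T₁) (hiso₂ : IsometricAction G T₂)
    (hnt₁ : NontrivialAction G T₁) (hnt₂ : NontrivialAction G T₂) :
    ∃ h : G, Hyperbolic T₁ h ∧ Hyperbolic T₂ h := by
  obtain ⟨a, ha⟩ := hnt₁
  obtain ⟨b, hb⟩ := hnt₂
  by_cases ha₂ : Hyperbolic T₂ a
  · exact ⟨a, ha, ha₂⟩
  by_cases hb₁ : Hyperbolic T₁ b
  · exact ⟨b, hb₁, hb⟩
  unfold Hyperbolic at ha₂ hb₁
  push Not at ha₂ hb₁
  rcases Hyperbolic.mul_elliptic hT₁ hiso₁ ha hb₁ with ⟨h1, h2⟩ | ⟨h1, h2⟩ <;>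
    rcases Hyperbolic.mul_elliptic hT₂ hiso₂ hb ha₂ with ⟨h3, h4⟩ | ⟨h3, h4⟩
  · exact ⟨_, h1, h3.mul_comm⟩
  · exact ⟨_, h2, h3.mul_comm⟩
  · exact ⟨_, h1, h4.mul_comm⟩
  · exact ⟨_, h2, h4.mul_comm⟩

/-- Corollary 1.5: if both actions are non-trivial and the minimal
subtree of `T₁` is dense, then every direction of `T₁` contains a positive semi-axis of
some element hyperbolic in both trees. -/
theorem exists_hyperbolic_with_semiaxis_in_direction
    {G T₁ T₂ : Type*} [Group G] [MetricSpace T₁] [MetricSpace T₂]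
    [MulAction G T₁] [MulAction G T₂]
    (hT₁ : IsRTree T₁) (hT₂ : IsRTree T₂)
    (hiso₁ : IsometricAction G T₁) (hiso₂ : IsometricAction G T₂)
    (hnt₁ : NontrivialAction G T₁) (hnt₂ : NontrivialAction G T₂)
    (hdense : Dense (minSubtree G T₁))
    (δ₁ : Set T₁) (hδ₁ : IsDirection δ₁) :
    ∃ h : G, Hyperbolic T₁ h ∧ Hyperbolic T₂ h ∧
      ∃ A : Set T₁, PosSemiAxis T₁ h A ∧ A ⊆ δ₁ := by
  obtain ⟨h, hh₁, hh₂⟩ := exists_hyperbolic_hyperbolic hT₁ hT₂ hiso₁ hiso₂ hnt₁ hnt₂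
  have ⟨q, _⟩ := hδ₁
  obtain ⟨ℓ, F, hℓ, hF, hhF⟩ := hh₁.exists_line hT₁ hiso₁ q
  obtain ⟨g, hg⟩ := hT₁.exists_smul_mem_direction hiso₁ hdense hδ₁ (F 0)
  have hline : ∀ t, (g * h * g⁻¹) • g • F t = g • F (t + ℓ) := fun t => by
    rw [smul_smul, inv_mul_cancel_right, mul_smul, hhF]
  rcases exists_semiaxis_of_line (F := fun t => g • F t) hiso₁ hℓ
    (fun s t => (hiso₁ g _ _).trans (hF s t)) hline hδ₁ hg with hA | hA
  · exact ⟨_, hh₁.conj g, hh₂.conj g, hA⟩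
  · exact ⟨_, (hh₁.conj g).inv, (hh₂.conj g).inv, hA⟩

end Guirardel
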